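/- Let N be a finite type of nodes, r : N a root, and p : N → N a parent map with p(r) = r such that for every node v there exists k with p^[k](v) = r. Say u is a descendant of v if p^[k](u) = v for some k ≥ 0, and call ℓ a leaf if no node v ≠ ℓ satisfies p(v) = ℓ. Let 𝕏 be a type of variables, χ : N → Set 𝕏 a labeling, and X : 𝕏. Assume: (i) for every non-leaf node v with X ∈ χ(v) there exists a node c with c ≠ v, p(c) = v, and X ∈ χ(c); (ii) for every node v with v ≠ r, X ∈ χ(v), and X ∉ χ(p(v)), every leaf ℓ with X ∈ χ(ℓ) is a descendant of v. If there exists a node whose label contains X, then there exists a unique node v with X ∈ χ(v) such that every node u with X ∈ χ(u) is a descendant of v. -/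

import Mathlib

/-- Unique owner of a variable in a view tree: in a finite rooted tree given by a
parent map `p` with root `r`, with node labels `χ : N → Set 𝕏`, if (i) every
non-leaf node whose label contains `X` has a child whose label contains `X`, and
(ii) whenever a node `v ≠ r` has `X` in its label but its parent does not, every
leaf whose label contains `X` is a descendant of `v`, then, provided some node's
label contains `X`, there is a unique node `v` with `X ∈ χ v` such that every node
whose label contains `X` is a descendant of `v`. -/
theorem unique_owner {N : Type*} [Fintype N] (r : N) (p : N → N)
    (hr : p r = r)
    (hroot : ∀ v : N, ∃ k : ℕ, p^[k] v = r)
    {𝕏 : Type*} (χ : N → Set 𝕏) (X : 𝕏)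
    (h1 : ∀ v : N, X ∈ χ v → (∃ c : N, c ≠ v ∧ p c = v) →
      ∃ c : N, c ≠ v ∧ p c = v ∧ X ∈ χ c)
    (h2 : ∀ v : N, v ≠ r → X ∈ χ v → X ∉ χ (p v) →
      ∀ ℓ : N, (∀ u : N, u ≠ ℓ → p u ≠ ℓ) → X ∈ χ ℓ → ∃ k : ℕ, p^[k] ℓ = v)
    (hex : ∃ v : N, X ∈ χ v) :
    ∃! v : N, X ∈ χ v ∧ ∀ u : N, X ∈ χ u → ∃ k : ℕ, p^[k] u = v := by
  classical
  obtain ⟨d, d0, ds⟩ : ∃ d : N → ℕ, (∀ v, d v = 0 → v = r) ∧ (∀ v, d (p v) = d v - 1) := by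
    refine ⟨fun v => Nat.find (hroot v), ?_, ?_⟩
    · intro v hv
      have h := Nat.find_spec (hroot v)
      simp only at hv
      rw [hv] at h
      exact h
    · intro v
      simp only
      apply le_antisymm
      · apply Nat.find_min'
        have h := Nat.find_spec (hroot v)
        rcases hn : Nat.find (hroot v) with _ | n
        · rw [hn] at h
          have h' : v = r := h
          simp [h', hr]
        · rw [hn, Function.iterate_succ_apply] at h
          simpa using h
      · have h : Nat.find (hroot v) ≤ Nat.find (hroot (p v)) + 1 := by
          apply Nat.find_min'
          rw [Function.iterate_succ_apply]
          exact Nat.find_spec (hroot (p v))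
        omega
  have dk : ∀ k v, d (p^[k] v) = d v - k := by
    intro k
    induction k with
    | zero => intro v; simp
    | succ k ih => intro v; rw [Function.iterate_succ_apply, ih, ds]; omega
  have hleaf : ∀ u, X ∈ χ u → ∃ l, (∀ w : N, w ≠ l → p w ≠ l) ∧ X ∈ χ l ∧
      ∃ j : ℕ, p^[j] l = u := by
    intro u hu
    obtain ⟨l, hl, hmax⟩ := Set.exists_max_image
      {w | X ∈ χ w ∧ ∃ j : ℕ, p^[j] w = u} d (Set.toFinite _) ⟨u, hu, 0, rfl⟩
    refine ⟨l, ?_, hl.1, hl.2⟩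
    intro w hw hpw
    obtain ⟨c, hc, hpc, hXc⟩ := h1 l hl.1 ⟨w, hw, hpw⟩
    obtain ⟨j, hj⟩ := hl.2
    have h := hmax c ⟨hXc, j + 1, by rw [Function.iterate_succ_apply, hpc, hj]⟩
    have h3 := ds c
    rw [hpc] at h3
    have h4 : c = r := d0 c (by omega)
    apply hc
    rw [← hpc, h4, hr]
  obtain ⟨v, hv, hmin⟩ := Set.exists_min_image {w | X ∈ χ w} d (Set.toFinite _) hex
  have hv' : X ∈ χ v := hv
  refine ⟨v, ⟨hv', ?_⟩, ?_⟩
  · intro u hu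
    by_cases hvr : v = r
    · rw [hvr]; exact hroot u
    have hpos : d v ≠ 0 := fun h => hvr (d0 v h)
    have hpv : X ∉ χ (p v) := by
      intro h
      have h3 := hmin (p v) h
      have h4 := ds v
      omega
    obtain ⟨l, hl, hXl, j, hj⟩ := hleaf u hu
    obtain ⟨k, hk⟩ := h2 v hvr hv' hpv l hl hXl
    rcases le_or_gt j k with h | h
    · refine ⟨k - j, ?_⟩
      rw [← hj, ← Function.iterate_add_apply, Nat.sub_add_cancel h, hk]
    · exfalso
      have h3 := hmin u hu
      have h4 := dk j l
      have h5 := dk k l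
      rw [hj] at h4
      rw [hk] at h5
      omega
  · rintro w ⟨hw, hall⟩
    obtain ⟨k, hk⟩ := hall v hv'
    have h3 := hmin w hw
    have h4 := dk k v
    rw [hk] at h4
    rcases Nat.eq_zero_or_pos k with h | h
    · subst h; exact hk.symm
    · rw [d0 v (by omega), d0 w (by omega)]
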